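/- The set Σ′_n of all elements (t′_{i_1})^{k_1} (t′_{i_2})^{k_2} ⋯ (t′_{i_r})^{k_r} · σ, where r ≥ 0, 0 ≤ i_1 < i_2 < ⋯ < i_r ≤ n−1, k_1, …, k_r ∈ ℤ∖{0}, and σ ranges over the Jones basis S_n of H_n(q), is a basis of H_{1,n}(q) as an R-module. -/

import Mathlib

set_option synthInstance.maxHeartbeats 1000000
set_option maxHeartbeats 2000000

namespace MB

/-! ## The mixed braid group `B_{1,n}` (with `m = n - 1` braiding generators) -/

/-- Generators: `none` is the looping generator `t`, `some i` is `σ_{i+1}` for `i : Fin m`. -/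
abbrev MBGen (m : ℕ) := Option (Fin m)

/-- The relators of the mixed braid group `B_{1,n}` (`m = n-1`):
`σ₁tσ₁t = tσ₁tσ₁`; `tσ_i = σ_i t` for `i > 1`; the braid relations among the `σ_i`. -/
def rels (m : ℕ) : Set (FreeGroup (MBGen m)) :=
  { r | (∃ h : 0 < m,
          r = (FreeGroup.of (some ⟨0, h⟩) * FreeGroup.of none) ^ 2 *
              ((FreeGroup.of (none : MBGen m) * FreeGroup.of (some ⟨0, h⟩)) ^ 2)⁻¹) ∨
        (∃ i : Fin m, 1 ≤ (i : ℕ) ∧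
          r = FreeGroup.of (none : MBGen m) * FreeGroup.of (some i) *
              (FreeGroup.of (some i) * FreeGroup.of (none : MBGen m))⁻¹) ∨
        (∃ i j : Fin m, (i : ℕ) + 1 = (j : ℕ) ∧
          r = FreeGroup.of (some i) * FreeGroup.of (some j) * FreeGroup.of (some i) *
              (FreeGroup.of (some j) * FreeGroup.of (some i) * FreeGroup.of (some j))⁻¹) ∨
        (∃ i j : Fin m, (i : ℕ) + 1 < (j : ℕ) ∧
          r = FreeGroup.of (some i) * FreeGroup.of (some j) *
              (FreeGroup.of (some j) * FreeGroup.of (some i))⁻¹) }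

/-- The mixed braid group `B_{1,n}` with `n = m+1` moving strands. -/
abbrev B (m : ℕ) := PresentedGroup (rels m)

/-- The braiding generator `σ_{i+1}`, for `i : Fin m`. -/
def σ {m : ℕ} (i : Fin m) : B m := PresentedGroup.of (some i)

/-- The looping generator `t`. -/
def τ {m : ℕ} : B m := PresentedGroup.of none

/-- `σ_j` in one-based indexing (`1 ≤ j ≤ m`), junk value `1` out of range. -/
def sig {m : ℕ} (j : ℕ) : B m :=
  if h : 1 ≤ j ∧ j - 1 < m then σ ⟨j - 1, h.2⟩ else 1

/-- The looping elements `t_i = σ_i ⋯ σ_1 t σ_1 ⋯ σ_i` (for `0 ≤ i ≤ m`), via `t_0 = t`,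
`t_{j+1} = σ_{j+1} t_j σ_{j+1}`. -/
def tt {m : ℕ} : ℕ → B m
  | 0 => τ
  | (j+1) => sig (j+1) * tt j * sig (j+1)

/-- The looping elements `t′_i = σ_i ⋯ σ_1 t σ_1⁻¹ ⋯ σ_i⁻¹` (for `0 ≤ i ≤ m`), via `t′_0 = t`,
`t′_{j+1} = σ_{j+1} t′_j σ_{j+1}⁻¹`. -/
def tp {m : ℕ} : ℕ → B m
  | 0 => τ
  | (j+1) => sig (j+1) * tp j * (sig (j+1))⁻¹

/-! ## The generalized Iwahori–Hecke algebra of type B, `H_{1,n}(q)` -/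

/-- The ground ring `R = ℂ[q^{±1}]` of Laurent polynomials. -/
abbrev R : Type := LaurentPolynomial ℂ

instance : IsDomain R := NoZeroDivisors.to_isDomain _

/-- The variable `q ∈ R`. -/
noncomputable def qq : R := LaurentPolynomial.T 1

/-- The quadratic Hecke relations `σ_i² = (q-1)σ_i + q`. -/
inductive heckeRel (m : ℕ) :
    MonoidAlgebra R (B m) → MonoidAlgebra R (B m) → Prop
  | quad (i : Fin m) : heckeRel m
      (MonoidAlgebra.of R (B m) (σ i) * MonoidAlgebra.of R (B m) (σ i))
      ((qq - 1) • MonoidAlgebra.of R (B m) (σ i) + qq • (1 : MonoidAlgebra R (B m)))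

/-- The generalized Iwahori–Hecke algebra of type B, `H_{1,n}(q)` (`n = m+1`), as the quotient
of the group algebra `R[B_{1,n}]` by the two-sided ideal generated by the quadratic relations. -/
abbrev H (m : ℕ) := RingQuot (heckeRel m)

/-- The canonical multiplicative map `π : B_{1,n} → H_{1,n}(q)`. -/
noncomputable def pih (m : ℕ) : B m →* H m :=
  (RingQuot.mkRingHom (heckeRel m)).toMonoidHom.comp (MonoidAlgebra.of R (B m))

/-- The subalgebra `H_n(q)` of `H_{1,n}(q)` generated by the images `g_1, …, g_{n-1}`
of `σ_1, …, σ_{n-1}`. -/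
noncomputable def HA (m : ℕ) : Subalgebra R (H m) :=
  Algebra.adjoin R (Set.range fun i : Fin m => pih m (σ i))

/-! ## Jones-basis words -/

/-- The descending product `σ_i σ_{i−1} ⋯ σ_{i−k}` (one-based indices). -/
def desc {m : ℕ} (i : ℕ) : ℕ → B m
  | 0 => sig i
  | (k+1) => desc i k * sig (i - (k+1))

/-- A Jones-basis word: a product `(σ_{i_1} ⋯ σ_{i_1−k_1}) ⋯ (σ_{i_p} ⋯ σ_{i_p−k_p})`
with `1 ≤ i_1 < ⋯ < i_p ≤ m` and `0 ≤ k_j ≤ i_j − 1`, including the empty word. -/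
def JonesWord {m : ℕ} (w : B m) : Prop :=
  ∃ (p : ℕ) (i : Fin p → ℕ) (k : Fin p → ℕ),
    StrictMono i ∧ (∀ j, 1 ≤ i j ∧ i j ≤ m) ∧ (∀ j, k j ≤ i j - 1) ∧
      w = (List.ofFn fun j => desc (i j) (k j)).prod

/-- The set `Σ′_n ⊆ H_{1,n}(q)` of elements `(t′_{i_1})^{k_1} ⋯ (t′_{i_r})^{k_r} · σ` with
`0 ≤ i_1 < ⋯ < i_r ≤ n−1`, nonzero integer exponents, and `σ` in the Jones basis of `H_n(q)`. -/
noncomputable def SigmaPrimeSet (m : ℕ) : Set (H m) :=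
  { x | ∃ (r : ℕ) (ind : Fin r → ℕ) (ke : Fin r → ℤ) (w : B m),
      StrictMono ind ∧ (∀ j, ind j ≤ m) ∧ (∀ j, ke j ≠ 0) ∧ JonesWord w ∧
      x = pih m ((List.ofFn fun j => tp (ind j) ^ ke j).prod * w) }

section
/-! ### Relations in the mixed braid group -/

theorem sig_of {m j : ℕ} (h1 : 1 ≤ j) (h2 : j ≤ m) :
    sig j = (σ ⟨j - 1, by omega⟩ : B m) := by
  unfold sig
  rw [dif_pos ⟨h1, by omega⟩]

theorem sig_junk {m j : ℕ} (h : ¬ (1 ≤ j ∧ j ≤ m)) : (sig j : B m) = 1 := by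
  unfold sig
  rw [dif_neg (by omega)]

theorem rel_eq {m : ℕ} {x y : FreeGroup (MBGen m)} (h : x * y⁻¹ ∈ rels m) :
    PresentedGroup.mk (rels m) x = PresentedGroup.mk (rels m) y := by
  have := PresentedGroup.one_of_mem h
  rw [map_mul, map_inv] at this
  exact mul_inv_eq_one.mp this

theorem sig_comm {m i j : ℕ} (h : i + 1 < j) :
    (sig i : B m) * sig j = sig j * sig i := by
  by_cases hi : 1 ≤ i ∧ i ≤ m
  · by_cases hj : 1 ≤ j ∧ j ≤ m
    · rw [sig_of hi.1 hi.2, sig_of hj.1 hj.2]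
      exact rel_eq (m := m) (x := FreeGroup.of (some ⟨i - 1, by omega⟩) * FreeGroup.of (some ⟨j - 1, by omega⟩))
        (y := FreeGroup.of (some ⟨j - 1, by omega⟩) * FreeGroup.of (some ⟨i - 1, by omega⟩))
        (Or.inr (Or.inr (Or.inr ⟨⟨i - 1, by omega⟩, ⟨j - 1, by omega⟩, (by show i - 1 + 1 < j - 1; omega), rfl⟩)))
    · rw [sig_junk hj]; simp
  · rw [sig_junk hi]; simp

theorem sig_comm' {m i j : ℕ} (h : i + 1 < j ∨ j + 1 < i) :
    (sig i : B m) * sig j = sig j * sig i := by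
  rcases h with h | h
  · exact sig_comm h
  · exact (sig_comm h).symm

theorem sig_braid {m i : ℕ} (h1 : 1 ≤ i) (h2 : i + 1 ≤ m) :
    (sig i : B m) * sig (i + 1) * sig i = sig (i + 1) * sig i * sig (i + 1) := by
  rw [sig_of h1 (by omega), sig_of (by omega : 1 ≤ i + 1) h2]
  exact rel_eq (m := m) (x := FreeGroup.of (some ⟨i - 1, by omega⟩) *
      FreeGroup.of (some ⟨i + 1 - 1, by omega⟩) * FreeGroup.of (some ⟨i - 1, by omega⟩))
    (y := FreeGroup.of (some ⟨i + 1 - 1, by omega⟩) * FreeGroup.of (some ⟨i - 1, by omega⟩) *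
      FreeGroup.of (some ⟨i + 1 - 1, by omega⟩))
    (Or.inr (Or.inr (Or.inl ⟨⟨i - 1, by omega⟩, ⟨i + 1 - 1, by omega⟩, (by show i - 1 + 1 = i + 1 - 1; omega), rfl⟩)))

theorem tau_comm {m i : ℕ} (h : 2 ≤ i) : (τ : B m) * sig i = sig i * τ := by
  by_cases hi : 1 ≤ i ∧ i ≤ m
  · rw [sig_of hi.1 hi.2]
    exact rel_eq (m := m) (x := FreeGroup.of none * FreeGroup.of (some ⟨i - 1, by omega⟩))
        (y := FreeGroup.of (some ⟨i - 1, by omega⟩) * FreeGroup.of none)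
        (Or.inr (Or.inl ⟨⟨i - 1, by omega⟩, (by show 1 ≤ i - 1; omega), rfl⟩))
  · rw [sig_junk hi]; simp

theorem tau_rel {m : ℕ} (h : 1 ≤ m) :
    ((sig 1 : B m) * τ) ^ 2 = (τ * sig 1) ^ 2 := by
  rw [sig_of le_rfl h]
  exact rel_eq (m := m) (x := (FreeGroup.of (some ⟨0, by omega⟩) * FreeGroup.of none) ^ 2)
        (y := (FreeGroup.of none * FreeGroup.of (some ⟨0, by omega⟩)) ^ 2)
        (Or.inl ⟨by omega, rfl⟩)

theorem comm_conj {G : Type*} [Group G] {a b c : G} (h1 : Commute a b) (h2 : Commute a c) :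
    Commute a (b * c * b⁻¹) := (h1.mul_right h2).mul_right h1.inv_right

theorem tp_comm_high {m : ℕ} : ∀ {i j : ℕ}, j + 1 < i → Commute (sig i : B m) (tp j)
  | i, 0, h => (tau_comm (by omega)).symm
  | i, j + 1, h => comm_conj (sig_comm' (by omega)) (tp_comm_high (by omega))

theorem tp_comm_low {m : ℕ} : ∀ {i j : ℕ}, 1 ≤ i → i < j → j ≤ m → Commute (sig i : B m) (tp j)
  | i, 0, h1, h, h2 => by omega
  | i, j + 1, h1, h, h2 => by
    by_cases hij : i < j
    · exact comm_conj (sig_comm' (by omega)) (tp_comm_low h1 hij (by omega))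
    · obtain rfl : i = j := by omega
      obtain ⟨k, rfl⟩ : ∃ k, i = k + 1 := ⟨i - 1, by omega⟩
      have hb := sig_braid (m := m) (i := k + 1) (by omega) h2
      have hc : Commute (sig (k + 1 + 1) : B m) (tp k) := tp_comm_high (by omega)
      simp only [tp]
      generalize (sig (k + 1) : B m) = a at *
      generalize (sig (k + 1 + 1) : B m) = b at *
      generalize (tp k : B m) = t at *
      have e : b * (a * t * a⁻¹) * b⁻¹ = (b * a) * t * (b * a)⁻¹ := by group
      rw [e]
      have h3 : a * (b * a) = (b * a) * b := by rw [← mul_assoc, hb]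
      have h4 : a = (b * a) * b * (b * a)⁻¹ := by rw [← h3]; group
      have h5 := (Commute.conj_iff (b * a)).mpr hc
      rwa [← h4] at h5

theorem tp_rel {m : ℕ} : ∀ {j : ℕ}, j + 1 ≤ m →
    ((sig (j + 1) : B m) * tp j) ^ 2 = (tp j * sig (j + 1)) ^ 2
  | 0, h => tau_rel h
  | j + 1, h => by
    have ih := tp_rel (m := m) (j := j) (by omega)
    have hb := sig_braid (m := m) (i := j + 1) (by omega) h
    have hc : Commute (sig (j + 1 + 1) : B m) (tp j) := tp_comm_high (by omega)
    simp only [tp]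
    generalize (sig (j + 1) : B m) = a at *
    generalize (sig (j + 1 + 1) : B m) = b at *
    generalize (tp j : B m) = t at *
    have h4 : b = (a * b) * a * (a * b)⁻¹ := by rw [hb]; group
    have h5 : a * t * a⁻¹ = (a * b) * t * (a * b)⁻¹ := by
      have : a * b * t * (a * b)⁻¹ = a * (b * t) * b⁻¹ * a⁻¹ := by group
      rw [this, hc.eq]; group
    rw [h5]
    generalize a * b = c at *
    rw [h4]
    have e1 : c * a * c⁻¹ * (c * t * c⁻¹) = c * (a * t) * c⁻¹ := by group
    have e2 : c * t * c⁻¹ * (c * a * c⁻¹) = c * (t * a) * c⁻¹ := by group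
    rw [e1, e2, conj_pow, conj_pow, ih]

/-! ### Normal forms -/

/-- `t′_0 ^ e_0 ⋯ t′_{n-1} ^ e_{n-1}`. -/
def TT {m : ℕ} (e : ℕ → ℤ) : ℕ → B m
  | 0 => 1
  | (n+1) => TT e n * tp n ^ e n

/-- The product of the first `k` letters of `σ_i σ_{i-1} ⋯`. -/
def DD {m : ℕ} (i : ℕ) : ℕ → B m
  | 0 => 1
  | (k+1) => DD i k * sig (i - k)

/-- Jones words by codes. -/
def JJ {m : ℕ} (c : ℕ → ℕ) : ℕ → B m
  | 0 => 1
  | (n+1) => JJ c n * DD (n+1) (c n)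

theorem DD_desc {m : ℕ} (i k : ℕ) : (DD i (k+1) : B m) = desc i k := by
  induction k with
  | zero => simp [DD, desc]
  | succ k ih => rw [DD, ih, desc]

theorem TT_congr {m : ℕ} {e e' : ℕ → ℤ} {n : ℕ} (h : ∀ i < n, e i = e' i) :
    (TT e n : B m) = TT e' n := by
  induction n with
  | zero => rfl
  | succ n ih => rw [TT, TT, ih (fun i hi => h i (by omega)), h n (by omega)]

theorem JJ_congr {m : ℕ} {e e' : ℕ → ℕ} {n : ℕ} (h : ∀ i < n, e i = e' i) :
    (JJ e n : B m) = JJ e' n := by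
  induction n with
  | zero => rfl
  | succ n ih => rw [JJ, JJ, ih (fun i hi => h i (by omega)), h n (by omega)]

theorem ofFn_prod_to_fun {M X : Type*} [Monoid M] (f : ℕ → X → M) (d : X) (PP : ℕ → X → Prop)
    (hd : ∀ i, f i d = 1) (hP : ∀ i, PP i d) (F : (ℕ → X) → ℕ → M) (F0 : ∀ c, F c 0 = 1)
    (Fs : ∀ c n, F c (n+1) = F c n * f n (c n))
    (Fc : ∀ c c' n, (∀ i < n, c i = c' i) → F c n = F c' n) :
    ∀ (n p : ℕ) (ind : Fin p → ℕ) (x : Fin p → X), StrictMono ind → (∀ j, ind j < n) →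
      (∀ j, PP (ind j) (x j)) →
      ∃ c : ℕ → X, (∀ i, PP i (c i)) ∧
        (List.ofFn fun j => f (ind j) (x j)).prod = F c n := by
  intro n
  induction n with
  | zero =>
    intro p ind x hm hl hx
    have : p = 0 := by
      by_contra h
      exact absurd (hl ⟨0, by omega⟩) (by omega)
    subst this
    exact ⟨fun _ => d, hP, by simp [F0]⟩
  | succ n ih =>
    intro p ind x hm hl hx
    by_cases h : ∀ j, ind j < n
    · obtain ⟨c, hc, he⟩ := ih p ind x hm h hx
      refine ⟨fun i => if i < n then c i else d, fun i => ?_, ?_⟩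
      · dsimp only; split_ifs
        · exact hc i
        · exact hP i
      · rw [Fs, he]
        simp only [lt_irrefl, if_false, hd, mul_one]
        exact Fc _ _ _ fun i hi => by simp [hi]
    · push Not at h
      obtain ⟨j, hj⟩ := h
      obtain ⟨p, rfl⟩ : ∃ p', p = p' + 1 := ⟨p - 1, by have := j.2; omega⟩
      have hlast : ind (Fin.last p) = n := by
        have := hm.monotone (Fin.le_last j)
        have := hl (Fin.last p)
        omega
      obtain ⟨c, hc, he⟩ := ih p (fun j => ind j.castSucc) (fun j => x j.castSucc)
        (fun a b hab => hm (by simpa using hab))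
        (fun j => by rw [← hlast]; exact hm (Fin.castSucc_lt_last j))
        (fun j => hx _)
      refine ⟨fun i => if i < n then c i else if i = n then x (Fin.last p) else d,
        fun i => ?_, ?_⟩
      · dsimp only; split_ifs with h1 h2
        · exact hc i
        · subst h2; have := hx (Fin.last p); rwa [hlast] at this
        · exact hP i
      · rw [Fs, List.ofFn_succ', List.concat_eq_append, List.prod_append, he, hlast]
        simp only [lt_irrefl, if_false, if_true, List.prod_singleton]
        congr 1
        exact Fc _ _ _ fun i hi => by simp [hi]

theorem fun_to_ofFn {M X : Type*} [Monoid M] (f : ℕ → X → M) (d : X)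
    (hd : ∀ i, f i d = 1) (F : (ℕ → X) → ℕ → M) (F0 : ∀ c, F c 0 = 1)
    (Fs : ∀ c n, F c (n+1) = F c n * f n (c n)) (c : ℕ → X) (n : ℕ) :
      ∃ (p : ℕ) (ind : Fin p → ℕ), StrictMono ind ∧ (∀ j, ind j < n) ∧ 
        (∀ j, c (ind j) ≠ d) ∧
        (List.ofFn fun j => f (ind j) (c (ind j))).prod = F c n := by
  induction n with
  | zero => exact ⟨0, fun i => i.elim0, fun i => i.elim0, fun i => i.elim0, fun i => i.elim0, by simp [F0]⟩
  | succ n ih =>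
    obtain ⟨p, ind, hm, hl, hx, he⟩ := ih
    by_cases h : c n = d
    · exact ⟨p, ind, hm, fun j => (hl j).trans (by omega), hx, by rw [Fs, h, hd, mul_one, he]⟩
    · refine ⟨p + 1, Fin.snoc ind n, ?_, ?_, ?_, ?_⟩
      · intro a b hab
        induction b using Fin.lastCases with
        | last =>
          induction a using Fin.lastCases with
          | last => exact absurd hab (lt_irrefl _)
          | cast a => simpa using hl a
        | cast b =>
          induction a using Fin.lastCases with
          | last => exact absurd (hab.trans (Fin.castSucc_lt_last b)) (lt_irrefl _)
          | cast a => simpa using hm (by simpa using hab)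
      · intro j
        induction j using Fin.lastCases with
        | last => simp
        | cast j => simpa using (hl j).trans (Nat.lt_succ_self n)
      · intro j
        induction j using Fin.lastCases with
        | last => simpa using h
        | cast j => simpa using hx j
      · rw [List.ofFn_succ', List.concat_eq_append, List.prod_append, Fs, ← he]
        simp

theorem jones_to_code {m : ℕ} {w : B m} (h : JonesWord w) :
    ∃ c : ℕ → ℕ, (∀ i, c i ≤ i + 1) ∧ w = JJ c m := by
  obtain ⟨p, i, k, hm, hi, hk, rfl⟩ := h
  obtain ⟨c, hc, he⟩ := ofFn_prod_to_fun (M := B m) (fun i k => DD (i+1) k) 0 (fun i k => k ≤ i + 1)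
    (fun i => rfl) (fun i => by simp) JJ (fun _ => rfl) (fun _ _ => rfl) (fun _ _ _ h => JJ_congr h)
    m p (fun j => i j - 1) (fun j => k j + 1)
    (fun a b hab => by have := hm hab; have := hi a; dsimp only; omega)
    (fun j => by have := hi j; omega)
    (fun j => by have := hi j; have := hk j; omega)
  refine ⟨c, hc, ?_⟩
  rw [← he]
  congr 2
  funext j
  rw [DD_desc, Nat.sub_add_cancel (hi j).1]

theorem code_to_jones {m : ℕ} {c : ℕ → ℕ} (hc : ∀ i, c i ≤ i + 1) :
    JonesWord (JJ c m : B m) := by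
  obtain ⟨p, ind, hm, hl, hx, he⟩ := fun_to_ofFn (M := B m) (fun i k => DD (i+1) k) 0
    (fun i => rfl) JJ (fun _ => rfl) (fun _ _ => rfl) c m
  refine ⟨p, fun j => ind j + 1, fun j => c (ind j) - 1, fun a b hab => ?_, fun j => ?_, fun j => ?_, ?_⟩
  · have := hm hab; dsimp only; omega
  · have := hl j; dsimp only; omega
  · have := hc (ind j); dsimp only; omega
  · rw [← he]
    congr 2
    funext j
    rw [← DD_desc, Nat.sub_add_cancel (Nat.one_le_iff_ne_zero.mpr (hx j))]

theorem sigmaPrime_iff {m : ℕ} (x : H m) : x ∈ SigmaPrimeSet m ↔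
    ∃ (e : ℕ → ℤ) (c : ℕ → ℕ), (∀ i, c i ≤ i + 1) ∧ x = pih m (TT e (m+1) * JJ c m) := by
  constructor
  · rintro ⟨r, ind, ke, w, hm, hi, hk, hw, rfl⟩
    obtain ⟨c, hc, rfl⟩ := jones_to_code hw
    obtain ⟨e, -, he⟩ := ofFn_prod_to_fun (M := B m) (fun i (k : ℤ) => tp i ^ k) 0 (fun i k => True)
      (fun i => zpow_zero _) (fun i => by simp) TT (fun _ => rfl) (fun _ _ => rfl)
      (fun _ _ _ h => TT_congr h)
      (m+1) r ind ke hm (fun j => by have := hi j; omega) (fun j => trivial)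
    exact ⟨e, c, hc, by rw [he]⟩
  · rintro ⟨e, c, hc, rfl⟩
    obtain ⟨p, ind, hm, hl, hx, he⟩ := fun_to_ofFn (M := B m) (fun i (k : ℤ) => tp i ^ k) 0
      (fun i => zpow_zero _) TT (fun _ => rfl) (fun _ _ => rfl) e (m+1)
    exact ⟨p, ind, fun j => e (ind j), JJ c m, hm, fun j => by have := hl j; omega, hx,
      code_to_jones hc, by rw [he]⟩

end

section
/-! ### More on descending words -/

theorem DD_comm_low {m n j : ℕ} : ∀ k, j + k < n → 
    (DD n k : B m) * sig j = sig j * DD n k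
  | 0, _ => by simp [DD]
  | k + 1, h => by
    have := DD_comm_low (m := m) (n := n) (j := j) k (by omega)
    rw [DD, mul_assoc, sig_comm' (i := n - k) (by omega), ← mul_assoc, this, mul_assoc]

theorem DD_shift {m n j : ℕ} (hn : n ≤ m) (hj : j ≤ n) : ∀ k, n + 1 < j + k → k ≤ n →
    (DD n k : B m) * sig j = sig (j - 1) * DD n k
  | 0, h, _ => by omega
  | k + 1, h, hk => by
    by_cases h1 : n + 1 < j + k
    · have := DD_shift hn hj k h1 (by omega)
      rw [DD, mul_assoc, sig_comm' (i := n - k) (by omega), ← mul_assoc, this, mul_assoc]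
    · obtain ⟨k, rfl⟩ : ∃ k', k = k' + 1 := ⟨k - 1, by omega⟩
      have e1 : n - k = j := by omega
      have e2 : n - (k + 1) = j - 1 := by omega
      have hb := sig_braid (m := m) (i := j - 1) (by omega) (by omega)
      rw [Nat.sub_add_cancel (by omega : 1 ≤ j)] at hb
      have hc := DD_comm_low (m := m) (n := n) (j := j - 1) k (by omega)
      rw [DD, DD, e1, e2]
      calc DD n k * sig j * sig (j - 1) * sig j = DD n k * (sig j * sig (j - 1) * sig j) := by group
        _ = (DD n k * sig (j - 1)) * sig j * sig (j - 1) := by rw [← hb]; group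
        _ = _ := by rw [hc]; group

section Span

variable {k A : Type*} [CommRing k] [Ring A] [Algebra k A] {m : ℕ}

/-- A multiplicative map satisfying the quadratic relation for all braiding generators. -/
def Quad (q : kˣ) (φ : B m →* A) : Prop :=
  ∀ i : Fin m, φ (σ i) * φ (σ i) = ((q : k) - 1) • φ (σ i) + (q : k) • 1

theorem Quad.sig {q : kˣ} {φ : B m →* A} (h : Quad q φ) {i : ℕ} (h1 : 1 ≤ i) (h2 : i ≤ m) :
    φ (sig i) * φ (sig i) = ((q : k) - 1) • φ (sig i) + (q : k) • 1 := by
  rw [sig_of h1 h2]; exact h _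

/-- The span of the Jones words with letters up to `n`. -/
def JS (k : Type*) [CommRing k] [Algebra k A] (φ : B m →* A) (n : ℕ) : Submodule k A :=
  Submodule.span k {x | ∃ c : ℕ → ℕ, (∀ i, c i ≤ i + 1) ∧ x = φ (JJ c n)}

theorem mul_mem_of_span {s : Set A} {S : Submodule k A} {x a : A} (hx : x ∈ Submodule.span k s)
    (h : ∀ y ∈ s, y * a ∈ S) : x * a ∈ S := by
  induction hx using Submodule.span_induction with
  | mem y hy => exact h y hy
  | zero => simp
  | add x y _ _ hx hy => rw [add_mul]; exact S.add_mem hx hy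
  | smul r x _ hx => rw [smul_mul_assoc]; exact S.smul_mem _ hx

theorem mem_mul_of_span {s : Set A} {S : Submodule k A} {x a : A} (hx : x ∈ Submodule.span k s)
    (h : ∀ y ∈ s, a * y ∈ S) : a * x ∈ S := by
  induction hx using Submodule.span_induction with
  | mem y hy => exact h y hy
  | zero => simp
  | add x y _ _ hx hy => rw [mul_add]; exact S.add_mem hx hy
  | smul r x _ hx => rw [mul_smul_comm]; exact S.smul_mem _ hx

theorem JS_mul_DD {φ : B m →* A} {n d : ℕ} (hd : d ≤ n + 1) {x : A} (hx : x ∈ JS k φ n) :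
    x * φ (DD (n+1) d) ∈ JS k φ (n+1) := by
  refine mul_mem_of_span hx ?_
  rintro y ⟨c, hc, rfl⟩
  refine Submodule.subset_span ⟨fun i => if i < n then c i else if i = n then d else 0, ?_, ?_⟩
  · intro i; dsimp only; have := hc i; split_ifs <;> omega
  · rw [JJ, map_mul]
    simp only [lt_irrefl, if_false, if_true]
    congr 2
    exact JJ_congr fun i hi => by simp [hi]

theorem JS_mul_sig {q : kˣ} {φ : B m →* A} (h : Quad q φ) : ∀ n, n ≤ m → ∀ j, 1 ≤ j → j ≤ n →
    ∀ x ∈ JS k φ n, x * φ (sig j) ∈ JS k φ n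
  | 0, _, j, h1, h2, _, _ => by omega
  | n + 1, hn, j, h1, h2, x, hx => by
    refine mul_mem_of_span hx ?_
    rintro y ⟨c, hc, rfl⟩
    have hJ : φ (JJ c n) ∈ JS k φ n := Submodule.subset_span ⟨c, hc, rfl⟩
    have hcn := hc n
    rw [JJ]
    generalize c n = d at hcn
    rw [map_mul, mul_assoc, ← map_mul φ (DD _ _)]
    by_cases ha : j + d < n + 1
    · rw [DD_comm_low _ ha, map_mul, ← mul_assoc]
      exact JS_mul_DD hcn (JS_mul_sig h n (by omega) j h1 (by omega) _ hJ)
    by_cases hb : j + d = n + 1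
    · have : (DD (n+1) d : B m) * sig j = DD (n+1) (d+1) := by
        rw [DD]; congr 2; omega
      rw [this]
      exact JS_mul_DD (by omega) hJ
    by_cases hb : j + d = n + 2
    · obtain ⟨d, rfl⟩ : ∃ d', d = d' + 1 := ⟨d - 1, by omega⟩
      have e : n + 1 - d = j := by omega
      have : φ (DD (n+1) (d+1) * sig j) =
          ((q : k) - 1) • φ (DD (n+1) (d+1)) + (q : k) • φ (DD (n+1) d) := by
        rw [DD, e, map_mul, map_mul, mul_assoc, h.sig h1 (by omega), mul_add]
        simp
      rw [this, mul_add, mul_smul_comm, mul_smul_comm]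
      exact Submodule.add_mem _ (Submodule.smul_mem _ _ (JS_mul_DD hcn hJ))
        (Submodule.smul_mem _ _ (JS_mul_DD (by omega) hJ))
    · rw [DD_shift hn h2 _ (by omega) hcn, map_mul, ← mul_assoc]
      exact JS_mul_DD hcn (JS_mul_sig h n (by omega) (j - 1) (by omega) (by omega) _ hJ)

theorem JS_one {φ : B m →* A} : (1 : A) ∈ JS k φ m := by
  refine Submodule.subset_span ⟨fun _ => 0, fun _ => by simp, ?_⟩
  have : ∀ n, (JJ (fun _ => 0) n : B m) = 1 := by
    intro n
    induction n with
    | zero => rfl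
    | succ n ih => rw [JJ, ih]; simp [DD]
  rw [this, map_one]

theorem JS_mul_DD' {q : kˣ} {φ : B m →* A} (h : Quad q φ) {n : ℕ} (hn : n ≤ m) :
    ∀ d, d ≤ n → ∀ x ∈ JS k φ m, x * φ (DD n d) ∈ JS k φ m
  | 0, _, x, hx => by simpa [DD] using hx
  | d + 1, hd, x, hx => by
    rw [DD, map_mul, ← mul_assoc]
    exact JS_mul_sig h m le_rfl _ (by omega) (by omega) _ (JS_mul_DD' h hn d (by omega) x hx)

theorem JS_mul_JJ {q : kˣ} {φ : B m →* A} (h : Quad q φ) {c : ℕ → ℕ} (hc : ∀ i, c i ≤ i + 1) :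
    ∀ n, n ≤ m → ∀ x ∈ JS k φ m, x * φ (JJ c n) ∈ JS k φ m
  | 0, _, x, hx => by simpa [JJ] using hx
  | n + 1, hn, x, hx => by
    rw [JJ, map_mul, ← mul_assoc]
    exact JS_mul_DD' h hn _ (hc n) _ (JS_mul_JJ h hc n (by omega) x hx)

theorem JS_sig_mul {q : kˣ} {φ : B m →* A} (h : Quad q φ) {i : ℕ} (h1 : 1 ≤ i) (h2 : i ≤ m)
    {x : A} (hx : x ∈ JS k φ m) : φ (sig i) * x ∈ JS k φ m := by
  refine mem_mul_of_span hx ?_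
  rintro y ⟨c, hc, rfl⟩
  refine JS_mul_JJ h hc m le_rfl _ ?_
  simpa using JS_mul_sig h m le_rfl i h1 h2 1 JS_one

/-! ### The rank two computation -/

/-- Span of `u^c v^d` and `u^c v^d g`, where `v = g u g⁻¹`. -/
def MM (k : Type*) [CommRing k] [Algebra k A] {G : Type*} [Group G] (φ : G →* A) (g u : G) :
    Submodule k A :=
  Submodule.span k {x | ∃ c d : ℤ, ∃ e : ℕ, (e = 0 ∨ e = 1) ∧
    x = φ (u ^ c * (g * u * g⁻¹) ^ d * g ^ e)}

section rank2
variable {G : Type*} [Group G] {φ : G →* A} {g u : G} {q : kˣ}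

theorem inv_formula (hq : φ g * φ g = ((q : k) - 1) • φ g + (q : k) • 1) :
    φ g⁻¹ = ((q⁻¹ : kˣ) : k) • (φ g - ((q : k) - 1) • 1) := by
  have h1 : φ g⁻¹ * φ g = 1 := by rw [← map_mul]; simp
  have h2 : φ g⁻¹ * (φ g * φ g) = φ g := by rw [← mul_assoc, h1, one_mul]
  rw [hq, mul_add, mul_smul_comm, mul_smul_comm, h1, mul_one] at h2
  rw [← h2]
  simp [smul_smul]

theorem MM_word (hq : φ g * φ g = ((q : k) - 1) • φ g + (q : k) • 1) (c d : ℤ) :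
    ∀ e : ℕ, φ (u ^ c * g * u ^ d * g ^ e) ∈ MM k φ g u ∧ φ (u ^ c * g ^ e) ∈ MM k φ g u
  | 0 => ⟨Submodule.subset_span ⟨c, d, 1, Or.inr rfl, by
        rw [conj_zpow]; congr 1; group⟩,
      Submodule.subset_span ⟨c, 0, 0, Or.inl rfl, by simp⟩⟩
  | 1 => by
    refine ⟨?_, Submodule.subset_span ⟨c, 0, 1, Or.inr rfl, by simp⟩⟩
    have : φ (u ^ c * g * u ^ d * g ^ 1) = ((q : k) - 1) • φ (u ^ c * (g * u * g⁻¹) ^ d * g ^ 1)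
        + (q : k) • φ (u ^ c * (g * u * g⁻¹) ^ d * g ^ 0) := by
      have e : u ^ c * g * u ^ d * g ^ 1 = u ^ c * (g * u * g⁻¹) ^ d * (g * g) := by
        rw [conj_zpow]; group
      rw [e, map_mul, map_mul φ g g, hq, mul_add]
      simp
    rw [this]
    exact Submodule.add_mem _ (Submodule.smul_mem _ _ (Submodule.subset_span ⟨c, d, 1, Or.inr rfl, rfl⟩))
      (Submodule.smul_mem _ _ (Submodule.subset_span ⟨c, d, 0, Or.inl rfl, rfl⟩))
  | e + 2 => by
    have h1 := MM_word hq c d e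
    have h2 := MM_word hq c d (e + 1)
    have key : ∀ b : G, φ (b * g ^ (e + 2)) = ((q : k) - 1) • φ (b * g ^ (e + 1)) +
        (q : k) • φ (b * g ^ e) := by
      intro b
      have e1 : b * g ^ (e + 2) = b * g ^ e * (g * g) := by
        rw [pow_add]; group
      rw [e1, map_mul, map_mul φ g g, hq, mul_add, pow_succ, ← mul_assoc, map_mul φ _ g]
      simp
    rw [key, key]
    exact ⟨Submodule.add_mem _ (Submodule.smul_mem _ _ h2.1) (Submodule.smul_mem _ _ h1.1),
      Submodule.add_mem _ (Submodule.smul_mem _ _ h2.2) (Submodule.smul_mem _ _ h1.2)⟩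

theorem MM_induct (hq : φ g * φ g = ((q : k) - 1) • φ g + (q : k) • 1) {S : Submodule k A} {a : A}
    (h1 : ∀ (c d : ℤ) (e : ℕ), a * φ (u ^ c * g * u ^ d * g ^ e) ∈ S)
    (h2 : ∀ (c : ℤ) (e : ℕ), a * φ (u ^ c * g ^ e) ∈ S) {x : A} (hx : x ∈ MM k φ g u) :
    a * x ∈ S := by
  refine mem_mul_of_span hx ?_
  rintro y ⟨c, d, e, rfl | rfl, rfl⟩
  · have e1 : u ^ c * (g * u * g⁻¹) ^ d * g ^ 0 = u ^ c * g * u ^ d * g⁻¹ := by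
      rw [conj_zpow]; group
    rw [e1, map_mul, inv_formula hq, mul_smul_comm, mul_sub, ← map_mul, mul_smul_comm, mul_smul_comm,
      mul_sub, mul_smul_comm]
    refine S.smul_mem _ (S.sub_mem ?_ (S.smul_mem _ ?_))
    · simpa using h1 c d 1
    · simpa using h1 c d 0
  · have e1 : u ^ c * (g * u * g⁻¹) ^ d * g ^ 1 = u ^ c * g * u ^ d * g ^ 0 := by
      rw [conj_zpow]; group
    rw [e1]; exact h1 _ _ _

theorem MM_Y (hq : φ g * φ g = ((q : k) - 1) • φ g + (q : k) • 1)
    (hr : (g * u) ^ 2 = (u * g) ^ 2) {x : A} (hx : x ∈ MM k φ g u) :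
    φ (g * u * g) * x ∈ MM k φ g u := by
  have hY : Commute (g * u * g) u := by
    have : g * u * g * u = u * (g * u * g) := by
      simpa [pow_two, mul_assoc] using hr
    exact this
  refine MM_induct hq ?_ ?_ hx
  · intro c d e
    have e1 : g * u * g * (u ^ c * g * u ^ d * g ^ e) = (u ^ c * g * u) * (g * g) * (u ^ d * g ^ e) := by
      have : g * u * g * (u ^ c * g * u ^ d * g ^ e) = (g * u * g * u ^ c) * g * u ^ d * g ^ e := by
        group
      rw [this, (hY.zpow_right c).eq]; group
    rw [← map_mul, e1, map_mul, map_mul, map_mul φ g g, hq, mul_add, add_mul, mul_smul_comm,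
      mul_smul_comm, mul_one, smul_mul_assoc, smul_mul_assoc, ← map_mul, ← map_mul, ← map_mul]
    refine Submodule.add_mem _ (Submodule.smul_mem _ _ ?_) (Submodule.smul_mem _ _ ?_)
    · have e2 : u ^ c * g * u * g * (u ^ d * g ^ e) = u ^ (c + d) * g * u ^ (1 : ℤ) * g ^ (e + 1) := by
        have : u ^ c * g * u * g * (u ^ d * g ^ e) = u ^ c * (g * u * g * u ^ d) * g ^ e := by group
        rw [this, (hY.zpow_right d).eq, zpow_add, pow_succ']; group
      rw [e2]; exact (MM_word hq _ _ _).1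
    · have e2 : u ^ c * g * u * (u ^ d * g ^ e) = u ^ c * g * u ^ (1 + d) * g ^ e := by
        rw [zpow_add]; group
      rw [e2]; exact (MM_word hq _ _ _).1
  · intro c e
    have e2 : g * u * g * (u ^ c * g ^ e) = u ^ c * g * u ^ (1 : ℤ) * g ^ (e + 1) := by
      have : g * u * g * (u ^ c * g ^ e) = (g * u * g * u ^ c) * g ^ e := by group
      rw [this, (hY.zpow_right c).eq, pow_succ']; group
    rw [← map_mul, e2]; exact (MM_word hq _ _ _).1

theorem MM_Yinv (hq : φ g * φ g = ((q : k) - 1) • φ g + (q : k) • 1)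
    (hr : (g * u) ^ 2 = (u * g) ^ 2) {x : A} (hx : x ∈ MM k φ g u) :
    φ (g * u * g)⁻¹ * x ∈ MM k φ g u := by
  have hY : Commute (g * u * g)⁻¹ u := by
    have : g * u * g * u = u * (g * u * g) := by
      simpa [pow_two, mul_assoc] using hr
    exact Commute.inv_left this
  have key : ∀ (c d : ℤ) (e : ℕ), φ (u ^ c * g⁻¹ * u ^ d * g ^ e) ∈ MM k φ g u := by
    intro c d e
    rw [map_mul, map_mul, map_mul, inv_formula hq, mul_smul_comm, smul_mul_assoc, smul_mul_assoc,
      mul_sub, sub_mul, sub_mul, mul_smul_comm, smul_mul_assoc, smul_mul_assoc, mul_one,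
      ← map_mul, ← map_mul, ← map_mul, ← map_mul, ← map_mul, ← zpow_add]
    exact Submodule.smul_mem _ _ (Submodule.sub_mem _ (MM_word hq _ _ _).1
      (Submodule.smul_mem _ _ (MM_word hq (c + d) d _).2))
  refine MM_induct hq ?_ ?_ hx
  · intro c d e
    have e1 : (g * u * g)⁻¹ * (u ^ c * g * u ^ d * g ^ e) = u ^ c * g⁻¹ * u ^ (-1 + d) * g ^ e := by
      have : (g * u * g)⁻¹ * (u ^ c * g * u ^ d * g ^ e) =
        ((g * u * g)⁻¹ * u ^ c) * g * u ^ d * g ^ e := by group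
      rw [this, (hY.zpow_right c).eq, zpow_add]; group
    rw [← map_mul, e1]; exact key _ _ _
  · intro c e
    have e1 : (g * u * g)⁻¹ * (u ^ c * g ^ e) = u ^ c * g⁻¹ * u ^ (-1 : ℤ) * g⁻¹ * g ^ e := by
      have : (g * u * g)⁻¹ * (u ^ c * g ^ e) = ((g * u * g)⁻¹ * u ^ c) * g ^ e := by group
      rw [this, (hY.zpow_right c).eq]; group
    rw [← map_mul, e1, map_mul, map_mul φ _ g⁻¹, inv_formula hq, mul_smul_comm, smul_mul_assoc, mul_sub,
      sub_mul, mul_smul_comm, smul_mul_assoc, mul_one, ← map_mul, ← map_mul, mul_assoc _ g,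
      ← pow_succ', ← map_mul]
    exact Submodule.smul_mem _ _ (Submodule.sub_mem _ (key _ _ _) (Submodule.smul_mem _ _ (key _ _ _)))

theorem MM_u (c : ℤ) {x : A} (hx : x ∈ MM k φ g u) : φ (u ^ c) * x ∈ MM k φ g u := by
  refine mem_mul_of_span hx ?_
  rintro y ⟨c', d, e, he, rfl⟩
  refine Submodule.subset_span ⟨c + c', d, e, he, ?_⟩
  rw [← map_mul, zpow_add]; congr 1; group

/-- key rank two fact -/
theorem MM_g_aux (hq : φ g * φ g = ((q : k) - 1) • φ g + (q : k) • 1)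
    (hr : (g * u) ^ 2 = (u * g) ^ 2) (c : ℤ) : ∀ {x : A}, x ∈ MM k φ g u → φ g * x ∈ MM k φ g u →
    φ g * (φ (u ^ c) * x) ∈ MM k φ g u := by
  induction c using Int.induction_on with
  | zero => intro x _ h; simpa using h
  | succ i ih =>
    intro x hx hgx
    have e : φ g * (φ (u ^ ((i : ℤ) + 1)) * x) = φ g * (φ (u ^ (i : ℤ)) * (φ u * x)) := by
      rw [zpow_add_one, map_mul, mul_assoc]
    rw [e]
    refine ih ?_ ?_
    · simpa using MM_u 1 hx
    · have e2 : φ g * (φ u * x) = φ (g * u * g) * (φ g⁻¹ * x) := by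
        rw [← mul_assoc, ← mul_assoc, ← map_mul, ← map_mul]; congr 2; group
      rw [e2]
      refine MM_Y hq hr ?_
      rw [inv_formula hq, smul_mul_assoc, sub_mul, smul_mul_assoc, one_mul]
      exact Submodule.smul_mem _ _ (Submodule.sub_mem _ hgx (Submodule.smul_mem _ _ hx))
  | pred i ih =>
    intro x hx hgx
    have e : φ g * (φ (u ^ (-(i : ℤ) - 1)) * x) = φ g * (φ (u ^ (-i : ℤ)) * (φ u⁻¹ * x)) := by
      rw [zpow_sub_one, map_mul, mul_assoc]
    rw [e]
    have hux : φ u⁻¹ * x ∈ MM k φ g u := by simpa using MM_u (-1) hx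
    refine ih hux ?_
    have e2 : φ g⁻¹ * (φ u⁻¹ * x) = φ (g * u * g)⁻¹ * (φ g * x) := by
      rw [← mul_assoc, ← mul_assoc, ← map_mul, ← map_mul]; congr 2; group
    have h3 : φ g⁻¹ * (φ u⁻¹ * x) ∈ MM k φ g u := by rw [e2]; exact MM_Yinv hq hr hgx
    have e3 : φ g = (q : k) • φ g⁻¹ + ((q : k) - 1) • 1 := by
      rw [inv_formula hq, smul_smul]; simp
    rw [e3, add_mul, smul_mul_assoc, smul_mul_assoc, one_mul]
    exact Submodule.add_mem _ (Submodule.smul_mem _ _ h3) (Submodule.smul_mem _ _ hux)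

theorem MM_g (hq : φ g * φ g = ((q : k) - 1) • φ g + (q : k) • 1)
    (hr : (g * u) ^ 2 = (u * g) ^ 2) {x : A} (hx : x ∈ MM k φ g u) : φ g * x ∈ MM k φ g u := by
  refine MM_induct hq ?_ ?_ hx
  · intro c d e
    rw [mul_assoc (u ^ c), mul_assoc (u ^ c), map_mul]
    refine MM_g_aux hq hr c ?_ ?_
    · simpa using (MM_word hq 0 d e).1
    · have : φ g * φ (g * u ^ d * g ^ e) = φ g * φ g * φ (u ^ d * g ^ e) := by
        rw [mul_assoc g, map_mul, mul_assoc]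
      rw [this, hq, add_mul, smul_mul_assoc, smul_mul_assoc, one_mul, ← map_mul]
      refine Submodule.add_mem _ (Submodule.smul_mem _ _ ?_) (Submodule.smul_mem _ _ ?_)
      · simpa [mul_assoc] using (MM_word hq 0 d e).1
      · exact (MM_word hq d d e).2
  · intro c e
    simpa [mul_assoc] using (MM_word hq 0 c e).1

end rank2

end Span

end

section
section Span

variable {k A : Type*} [CommRing k] [Ring A] [Algebra k A] {m : ℕ}

/-- Span of `t′^e` and `t′^e g_i`. -/
def TS (k : Type*) [CommRing k] [Algebra k A] (φ : B m →* A) (i n : ℕ) : Submodule k A :=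
  Submodule.span k {x | ∃ f : ℕ → ℤ, ∃ e : ℕ, (e = 0 ∨ e = 1) ∧ x = φ (TT f n * sig i ^ e)}

theorem TT_comm {i : ℕ} (f : ℕ → ℤ) : ∀ n, n ≤ i - 1 → Commute (sig i : B m) (TT f n)
  | 0, _ => Commute.one_right _
  | n + 1, h => (TT_comm f n (by omega)).mul_right ((tp_comm_high (by omega)).zpow_right _)

theorem sig_TT {q : kˣ} {φ : B m →* A} (h : Quad q φ) {i : ℕ} (hi : i + 1 ≤ m) (f : ℕ → ℤ) (n : ℕ)
    (hn : i + 2 ≤ n) : n ≤ m + 1 → φ (sig (i+1)) * φ (TT f n) ∈ TS k φ (i+1) n := by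
  induction n, hn using Nat.le_induction with
  | base =>
    intro _
    have hM : φ (tp i ^ f i * tp (i+1) ^ f (i+1)) ∈ MM k φ (sig (i+1)) (tp i) :=
      Submodule.subset_span ⟨f i, f (i+1), 0, Or.inl rfl, by simp [tp]⟩
    have hM2 := MM_g (h.sig (by omega) hi) (tp_rel hi) hM
    have e1 : φ (sig (i+1)) * φ (TT f (i+2)) =
        φ (TT f i) * (φ (sig (i+1)) * φ (tp i ^ f i * tp (i+1) ^ f (i+1))) := by
      rw [← map_mul, ← map_mul, ← map_mul, ← mul_assoc (TT f i),
        ← (TT_comm (i := i+1) f i (by omega)).eq, TT, TT]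
      congr 1; group
    rw [e1]
    refine mem_mul_of_span hM2 ?_
    rintro y ⟨c, d, e, he, rfl⟩
    refine Submodule.subset_span ⟨fun j => if j < i then f j else if j = i then c else d, e, he, ?_⟩
    have e2 : (TT (fun j => if j < i then f j else if j = i then c else d) i : B m) = TT f i :=
      TT_congr fun j hj => by simp [hj]
    rw [← map_mul, TT, TT, e2]
    simp [tp, mul_assoc]
  | succ n hn ih =>
    intro hm
    have ih := ih (by omega)
    rw [TT, map_mul, ← mul_assoc]
    refine mul_mem_of_span ih ?_
    rintro y ⟨f', e, he, rfl⟩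
    refine Submodule.subset_span ⟨fun j => if j < n then f' j else f n, e, he, ?_⟩
    have e2 : (TT (fun j => if j < n then f' j else f n) n : B m) = TT f' n :=
      TT_congr fun j hj => by simp [hj]
    have e3 : Commute ((sig (i+1) : B m) ^ e) (tp n ^ f n) :=
      ((tp_comm_low (by omega) (by omega) (by omega)).pow_left e).zpow_right _
    rw [← map_mul, TT, e2, mul_assoc, e3.eq]
    simp [mul_assoc]

theorem tp0_TT (f : ℕ → ℤ) (c : ℤ) : ∀ n, 
    (tp 0 : B m) ^ c * TT f (n+1) = TT (fun j => if j = 0 then c + f 0 else f j) (n+1)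
  | 0 => by simp [TT, zpow_add]
  | n + 1 => by
    rw [TT, ← mul_assoc, tp0_TT f c n, TT.eq_2 _ (n+1)]
    simp

/-- The span of the basis. -/
def FS (k : Type*) [CommRing k] [Algebra k A] (φ : B m →* A) : Submodule k A :=
  Submodule.span k {x | ∃ (e : ℕ → ℤ) (c : ℕ → ℕ), (∀ i, c i ≤ i + 1) ∧
    x = φ (TT e (m+1) * JJ c m)}

theorem FS_mul {φ : B m →* A} (f : ℕ → ℤ) {x : A} (hx : x ∈ JS k φ m) :
    φ (TT f (m+1)) * x ∈ FS k φ := by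
  refine mem_mul_of_span hx ?_
  rintro y ⟨c, hc, rfl⟩
  exact Submodule.subset_span ⟨f, c, hc, by rw [map_mul]⟩

theorem FS_sig {q : kˣ} {φ : B m →* A} (h : Quad q φ) {i : ℕ} (hi : i + 1 ≤ m) {x : A}
    (hx : x ∈ FS k φ) : φ (sig (i+1)) * x ∈ FS k φ := by
  refine mem_mul_of_span hx ?_
  rintro y ⟨f, c, hc, rfl⟩
  rw [map_mul, ← mul_assoc]
  refine mul_mem_of_span (sig_TT h hi f (m+1) (by omega) le_rfl) ?_
  have hJ : φ (JJ c m) ∈ JS k φ m := Submodule.subset_span ⟨c, hc, rfl⟩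
  rintro y ⟨f', e, rfl | rfl, rfl⟩
  · rw [map_mul, mul_assoc]
    refine FS_mul _ ?_
    simpa using hJ
  · rw [map_mul, mul_assoc]
    refine FS_mul _ ?_
    simpa using JS_sig_mul h (by omega) hi hJ

theorem FS_tau {φ : B m →* A} (c : ℤ) {x : A} (hx : x ∈ FS k φ) :
    φ (τ ^ c) * x ∈ FS k φ := by
  refine mem_mul_of_span hx ?_
  rintro y ⟨f, c', hc, rfl⟩
  refine Submodule.subset_span ⟨fun j => if j = 0 then c + f 0 else f j, c', hc, ?_⟩
  rw [← map_mul, ← mul_assoc]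
  congr 2
  exact tp0_TT f c m

theorem FS_all {q : kˣ} {φ : B m →* A} (h : Quad q φ) (b : B m) :
    ∀ x ∈ FS k φ, φ b * x ∈ FS k φ := by
  have hb : b ∈ Subgroup.closure (Set.range (PresentedGroup.of (rels := rels m))) := by
    rw [PresentedGroup.closure_range_of]; trivial
  have hs : ∀ (i : Fin m), ∀ x ∈ FS k φ, φ (σ i) * x ∈ FS k φ := by
    intro i x hx
    have := FS_sig h (i := i) (by omega) hx
    rwa [sig_of (by omega) (by omega)] at this
  induction hb using Subgroup.closure_induction'' with
  | mem b hb =>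
    obtain ⟨_ | i, rfl⟩ := hb
    · intro x hx
      have := FS_tau 1 hx
      rwa [zpow_one] at this
    · exact hs i
  | inv_mem b hb =>
    obtain ⟨_ | i, rfl⟩ := hb
    · intro x hx
      have := FS_tau (-1) hx
      rwa [zpow_neg_one] at this
    · intro x hx
      have := inv_formula (h i)
      change φ (σ i)⁻¹ * x ∈ _
      rw [this, smul_mul_assoc, sub_mul, smul_mul_assoc, one_mul]
      exact Submodule.smul_mem _ _ (Submodule.sub_mem _ (hs i x hx) (Submodule.smul_mem _ _ hx))
  | one => intro x hx; simpa using hx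
  | mul a b _ _ ha hb =>
    intro x hx
    rw [map_mul, mul_assoc]
    exact ha _ (hb _ hx)

theorem FS_mem {q : kˣ} {φ : B m →* A} (h : Quad q φ) (b : B m) : φ b ∈ FS k φ := by
  have h1 : (1 : A) ∈ FS k φ := by
    have := FS_mul (φ := φ) (fun _ => 0) JS_one (k := k)
    have e : ∀ n, (TT (fun _ => 0) n : B m) = 1 := by
      intro n
      induction n with
      | zero => rfl
      | succ n ih => rw [TT, ih]; simp
    simpa [e] using this
  simpa using FS_all h b 1 h1

end Span

theorem qq_unit : ∃ q : Rˣ, (q : R) = qq := LaurentPolynomial.isUnit_T 1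

theorem pih_apply (m : ℕ) (b : B m) :
    pih m b = RingQuot.mkAlgHom R (heckeRel m) (MonoidAlgebra.of R (B m) b) := by
  rw [← AlgHom.coe_toRingHom, RingQuot.mkAlgHom_coe]; rfl

theorem pih_quad (m : ℕ) {q : Rˣ} (hq : (q : R) = qq) : Quad (A := H m) q (pih m) := by
  intro i
  rw [pih_apply, ← map_mul, RingQuot.mkAlgHom_rel R (heckeRel.quad i), map_add, map_smul, map_smul,
    map_one, hq]

theorem span_top (m : ℕ) : Submodule.span R (SigmaPrimeSet m) = ⊤ := by
  obtain ⟨q, hq⟩ := qq_unit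
  have e : Submodule.span R (SigmaPrimeSet m) = FS (A := H m) R (pih m) := by
    unfold FS
    congr 1
    ext x
    exact sigmaPrime_iff x
  rw [e, eq_top_iff]
  rintro x -
  obtain ⟨y, rfl⟩ := RingQuot.mkAlgHom_surjective R (heckeRel m) x
  induction y using MonoidAlgebra.induction_on with
  | of b => rw [← pih_apply]; exact FS_mem (pih_quad m hq) b
  | add a b ha hb => rw [map_add]; exact Submodule.add_mem _ ha hb
  | smul r a ha => rw [map_smul]; exact Submodule.smul_mem _ _ ha

end

section
/-- Data for a Demazure–Lusztig type representation. -/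
structure RepData (k P : Type*) [CommRing k] [CommRing P] [Algebra k P] where
  q : kˣ
  act : Equiv.Perm ℕ →* (P →ₐ[k] P)
  al : ℕ → ℕ → P
  x : ℕ → Pˣ
  act_al : ∀ π i j, act π (al i j) = al (π i) (π j)
  act_x : ∀ π i, act π (x i) = x (π i)
  a1 : ∀ i j, i ≠ j → al i j + al j i = algebraMap k P q - 1
  a2 : ∀ i j l, i ≠ j → i ≠ l → j ≠ l → al i j * al j l + al i l * al j i = al j l * al i l
  a3 : ∀ i j, i ≠ j → al i j * x i + x j * al j i = 0

namespace RepData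
variable {k P : Type*} [CommRing k] [CommRing P] [Algebra k P] (D : RepData k P)

/-- The operator of `g_{i+1}`. -/
def Top (i : ℕ) : Module.End k P :=
  LinearMap.mulLeft k (D.al i (i+1)) +
    LinearMap.mulLeft k (algebraMap k P D.q - D.al i (i+1)) ∘ₗ (D.act (Equiv.swap i (i+1))).toLinearMap

theorem Top_apply (i : ℕ) (f : P) : D.Top i f = D.al i (i+1) * f +
    (algebraMap k P D.q - D.al i (i+1)) * D.act (Equiv.swap i (i+1)) f := rfl

theorem act_act (π ρ : Equiv.Perm ℕ) (f : P) : D.act π (D.act ρ f) = D.act (π * ρ) f := by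
  rw [map_mul]; rfl

theorem act_one (f : P) : D.act 1 f = f := by rw [map_one]; rfl

theorem act_swap_swap (i j : ℕ) (f : P) :
    D.act (Equiv.swap i j) (D.act (Equiv.swap i j) f) = f := by
  rw [act_act, Equiv.swap_mul_self, act_one]

theorem Top_quad (i : ℕ) : D.Top i * D.Top i = ((D.q : k) - 1) • D.Top i + (D.q : k) • 1 := by
  ext f
  have h1 := D.a1 i (i+1) (by omega)
  simp only [Module.End.mul_apply, Top_apply, LinearMap.add_apply, LinearMap.smul_apply, map_add,
    map_mul, map_sub, AlgHom.commutes, act_al, act_swap_swap,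
    Equiv.swap_apply_left, Equiv.swap_apply_right, Module.End.one_apply]
  simp only [Algebra.smul_def, map_sub, map_one]
  have h2 : D.al (i+1) i = algebraMap k P D.q - 1 - D.al i (i+1) := by rw [← h1]; ring
  rw [h2]; ring

theorem Top_far (i j : ℕ) (h : i + 1 < j) : D.Top i * D.Top j = D.Top j * D.Top i := by
  ext f
  have e1 : Equiv.swap i (i+1) j = j := Equiv.swap_apply_of_ne_of_ne (by omega) (by omega)
  have e2 : Equiv.swap i (i+1) (j+1) = j+1 := Equiv.swap_apply_of_ne_of_ne (by omega) (by omega)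
  have e3 : Equiv.swap j (j+1) i = i := Equiv.swap_apply_of_ne_of_ne (by omega) (by omega)
  have e4 : Equiv.swap j (j+1) (i+1) = i+1 := Equiv.swap_apply_of_ne_of_ne (by omega) (by omega)
  have e5 : Equiv.swap i (i+1) * Equiv.swap j (j+1) = Equiv.swap j (j+1) * Equiv.swap i (i+1) := by
    rw [Equiv.mul_swap_eq_swap_mul, e1, e2]
  simp only [Module.End.mul_apply, Top_apply, map_add,
    map_mul, map_sub, AlgHom.commutes, act_al, act_act, e1, e2, e3, e4, e5]
  ring

theorem Top_braid (i : ℕ) :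
    D.Top i * D.Top (i+1) * D.Top i = D.Top (i+1) * D.Top i * D.Top (i+1) := by
  ext f
  have e1 : Equiv.swap i (i+1) (i+1+1) = i+1+1 := Equiv.swap_apply_of_ne_of_ne (by omega) (by omega)
  have e3 : Equiv.swap (i+1) (i+1+1) i = i := Equiv.swap_apply_of_ne_of_ne (by omega) (by omega)
  have e5 : Equiv.swap i (i+1) * (Equiv.swap (i+1) (i+1+1) * Equiv.swap i (i+1)) =
      Equiv.swap (i+1) (i+1+1) * (Equiv.swap i (i+1) * Equiv.swap (i+1) (i+1+1)) := by
    ext n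
    simp only [Equiv.Perm.mul_apply, Equiv.swap_apply_def]
    split_ifs <;> omega
  have e6 : D.act (Equiv.swap i (i+1)) (D.act (Equiv.swap (i+1) (i+1+1)) (D.act (Equiv.swap i (i+1)) f))
    = D.act (Equiv.swap (i+1) (i+1+1)) (D.act (Equiv.swap i (i+1))
      (D.act (Equiv.swap (i+1) (i+1+1)) f)) := by
    simp only [act_act, e5]
  have h1 : D.al (i+1) i = algebraMap k P D.q - 1 - D.al i (i+1) := by
    rw [← D.a1 i (i+1) (by omega)]; ring
  have h2 : D.al (i+1+1) (i+1) = algebraMap k P D.q - 1 - D.al (i+1) (i+1+1) := by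
    rw [← D.a1 (i+1) (i+1+1) (by omega)]; ring
  have h3 := D.a2 i (i+1) (i+1+1) (by omega) (by omega) (by omega)
  simp only [Module.End.mul_apply, Top_apply, map_add,
    map_mul, map_sub, AlgHom.commutes, act_al, act_swap_swap, e1, e3, e6, Equiv.swap_apply_left,
    Equiv.swap_apply_right, h1, h2]
  rw [h1] at h3
  linear_combination ((D.al i (i+1) - D.al (i+1) (i+1+1)) * f +
    (algebraMap k P D.q - D.al i (i+1)) * D.act (Equiv.swap i (i+1)) f -
    (algebraMap k P D.q - D.al (i+1) (i+1+1)) * D.act (Equiv.swap (i+1) (i+1+1)) f) * h3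

/-- The operator of `t`. -/
def Xop : Module.End k P := LinearMap.mulLeft k (D.x 0 : P)

theorem Xop_apply (f : P) : D.Xop f = D.x 0 * f := rfl

theorem Xop_comm (i : ℕ) (h : 1 ≤ i) : D.Xop * D.Top i = D.Top i * D.Xop := by
  ext f
  have e1 : Equiv.swap i (i+1) 0 = 0 := Equiv.swap_apply_of_ne_of_ne (by omega) (by omega)
  simp only [Module.End.mul_apply, Top_apply, Xop_apply, map_mul, act_x, e1]
  ring

theorem Xop_rel : (D.Top 0 * D.Xop) * (D.Top 0 * D.Xop) = (D.Xop * D.Top 0) * (D.Xop * D.Top 0) := by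
  have key : ∀ f, D.Top 0 (D.x 0 * D.Top 0 f) = (D.al 0 1 * D.x 0 * D.al 0 1 +
      (algebraMap k P D.q - D.al 0 1) * D.x 1 * (algebraMap k P D.q - D.al 1 0)) * f := by
    intro f
    have h3 := D.a3 0 1 (by omega)
    simp only [Top_apply, map_add,
      map_mul, map_sub, AlgHom.commutes, act_al, act_act, act_x, zero_add, Equiv.swap_apply_left,
      Equiv.swap_apply_right, Equiv.swap_mul_self, act_one]
    linear_combination (algebraMap k P D.q - D.al 0 1) * D.act (Equiv.swap 0 1) f * h3
  ext f
  simp only [Module.End.mul_apply, Xop_apply, key]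
  ring

/-- The operator of `g_{i+1}` as a unit. -/
def Tunit (i : ℕ) : (Module.End k P)ˣ where
  val := D.Top i
  inv := ((D.q⁻¹ : kˣ) : k) • (D.Top i - ((D.q : k) - 1) • 1)
  val_inv := by
    rw [mul_smul_comm, mul_sub, mul_smul_comm, mul_one, D.Top_quad, add_sub_cancel_left, smul_smul]
    simp
  inv_val := by
    rw [smul_mul_assoc, sub_mul, smul_mul_assoc, one_mul, D.Top_quad, add_sub_cancel_left, smul_smul]
    simp

/-- The operator of `t` as a unit. -/
def Xunit : (Module.End k P)ˣ where
  val := D.Xop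
  inv := LinearMap.mulLeft k ((D.x 0)⁻¹ : Pˣ)
  val_inv := by ext f; simp [Xop]
  inv_val := by ext f; simp [Xop]

/-- Images of the generators. -/
def genMap (m : ℕ) : MBGen m → (Module.End k P)ˣ
  | none => D.Xunit
  | some i => D.Tunit i

theorem genMap_rels (m : ℕ) : ∀ r ∈ rels m, FreeGroup.lift (D.genMap m) r = 1 := by
  rintro r (⟨h, rfl⟩ | ⟨i, hi, rfl⟩ | ⟨i, j, hij, rfl⟩ | ⟨i, j, hij, rfl⟩)
  · rw [map_mul, map_inv, mul_inv_eq_one]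
    simp only [map_mul, map_pow, FreeGroup.lift_apply_of, genMap, pow_two]
    exact Units.ext D.Xop_rel
  · rw [map_mul, map_inv, mul_inv_eq_one]
    simp only [map_mul, FreeGroup.lift_apply_of, genMap]
    exact Units.ext (D.Xop_comm _ hi)
  · rw [map_mul, map_inv, mul_inv_eq_one]
    simp only [map_mul, FreeGroup.lift_apply_of, genMap, ← hij]
    exact Units.ext (D.Top_braid _)
  · rw [map_mul, map_inv, mul_inv_eq_one]
    simp only [map_mul, FreeGroup.lift_apply_of, genMap]
    exact Units.ext (D.Top_far _ _ hij)

/-- The representation of the mixed braid group. -/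
def rho (m : ℕ) : B m →* (Module.End k P)ˣ := PresentedGroup.toGroup (D.genMap_rels m)

theorem rho_sigma {m : ℕ} (i : Fin m) : (D.rho m (σ i) : Module.End k P) = D.Top i := by
  unfold rho σ; rw [PresentedGroup.toGroup.of]; rfl

theorem rho_tau {m : ℕ} : (D.rho m τ : Module.End k P) = D.Xop := by
  unfold rho τ; rw [PresentedGroup.toGroup.of]; rfl

end RepData

/-- The representation of the Hecke algebra. -/
theorem exists_rep {P : Type*} [CommRing P] [Algebra R P] (D : RepData R P) (hq : (D.q : R) = qq)
    (m : ℕ) : ∃ F : H m →ₐ[R] Module.End R P, ∀ b, F (pih m b) = D.rho m b := by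
  let f : MonoidAlgebra R (B m) →ₐ[R] Module.End R P :=
    MonoidAlgebra.lift R _ (B m) ((Units.coeHom _).comp (D.rho m))
  have hf : ∀ b, f (MonoidAlgebra.of R (B m) b) = D.rho m b := fun b => by
    simp [f]
  have h : ∀ ⦃x y⦄, heckeRel m x y → f x = f y := by
    rintro _ _ ⟨i⟩
    rw [map_mul, map_add, map_smul, map_smul, map_one, hf, RepData.rho_sigma, RepData.Top_quad, hq]
  refine ⟨RingQuot.liftAlgHom R ⟨f, h⟩, fun b => ?_⟩
  rw [pih_apply, RingQuot.liftAlgHom_mkAlgHom_apply, hf]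

end

section
/-- A field with commuting indeterminates and an action of the permutations. -/
structure FieldData (K : Type) [Field K] [Algebra ℂ K] where
  act : Equiv.Perm ℕ →* (K →ₐ[ℂ] K)
  act_inj : Function.Injective act
  mon : (ℕ →₀ ℤ) → K
  mon_zero : mon 0 = 1
  mon_add : ∀ a b, mon (a + b) = mon a * mon b
  mon_li : LinearIndependent ℂ mon
  act_x : ∀ π i, act π (mon (Finsupp.single i 1)) = mon (Finsupp.single (π i) 1)

/-- The Laurent monomials algebra. -/
abbrev A0 : Type := AddMonoidAlgebra ℂ (ℕ →₀ ℤ)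

/-- The permutation action on the Laurent polynomials. -/
noncomputable def actA (π : Equiv.Perm ℕ) : A0 ≃ₐ[ℂ] A0 :=
  AddMonoidAlgebra.domCongr ℂ ℂ (Finsupp.domCongr π)

theorem actA_single (π : Equiv.Perm ℕ) (a : ℕ →₀ ℤ) (c : ℂ) :
    actA π (AddMonoidAlgebra.single a c) = AddMonoidAlgebra.single (Finsupp.equivMapDomain π a) c := by
  simp [actA]

theorem actA_one (a : A0) : actA 1 a = a := by
  have : (actA 1).toAlgHom = AlgHom.id ℂ A0 := by
    apply AddMonoidAlgebra.algHom_ext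
    intro x
    have : Finsupp.equivMapDomain 1 x = x := Finsupp.equivMapDomain_refl x
    simp [actA_single, this]
    exact Subsingleton.elim _ _
  exact DFunLike.congr_fun this a

theorem actA_mul (π ρ : Equiv.Perm ℕ) (a : A0) : actA (π * ρ) a = actA π (actA ρ a) := by
  have : (actA (π * ρ)).toAlgHom = (actA π).toAlgHom.comp (actA ρ).toAlgHom := by
    apply AddMonoidAlgebra.algHom_ext
    intro x
    have : Finsupp.equivMapDomain (π * ρ) x =
      Finsupp.equivMapDomain π (Finsupp.equivMapDomain ρ x) := Finsupp.equivMapDomain_trans _ _ x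
    simp [actA_single, this]
    exact Subsingleton.elim _ _
  exact DFunLike.congr_fun this a

theorem single_li : LinearIndependent ℂ (fun a : ℕ →₀ ℤ => (AddMonoidAlgebra.single a 1 : A0)) := by
  have h := (AddMonoidAlgebra.basis (ℕ →₀ ℤ) ℂ).linearIndependent
  convert h using 1
  ext a
  simp

section
variable {K : Type} [Field K] [Algebra A0 K] [IsFractionRing A0 K] [Algebra ℂ K]
  [IsScalarTower ℂ A0 K]

variable (K) in
/-- The permutation action on the fraction field. -/
noncomputable def actK (π : Equiv.Perm ℕ) : K →+* K :=
  (IsFractionRing.ringEquivOfRingEquiv (A := A0) (K := K) (B := A0) (L := K) (actA π).toRingEquiv).toRingHom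

theorem actK_algebraMap (π : Equiv.Perm ℕ) (a : A0) :
    actK K π (algebraMap A0 K a) = algebraMap A0 K (actA π a) :=
  IsFractionRing.ringEquivOfRingEquiv_algebraMap _ _

theorem ext_K {f g : K →+* K} (h : ∀ a, f (algebraMap A0 K a) = g (algebraMap A0 K a)) : f = g :=
  IsLocalization.ringHom_ext (nonZeroDivisors A0) (RingHom.ext h)

theorem actK_commutes (π : Equiv.Perm ℕ) (c : ℂ) : actK K π (algebraMap ℂ K c) = algebraMap ℂ K c := by
  rw [IsScalarTower.algebraMap_apply ℂ A0 K, actK_algebraMap, AlgEquiv.commutes]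

variable (K) in
/-- The concrete data. -/
noncomputable def fieldData : FieldData K where
  act :=
    { toFun := fun π => { actK K π with commutes' := actK_commutes π }
      map_one' := by
        apply AlgHom.coe_ringHom_injective
        apply ext_K
        intro a
        change actK K 1 _ = _
        rw [actK_algebraMap, actA_one]; rfl
      map_mul' := by
        intro π ρ
        apply AlgHom.coe_ringHom_injective
        apply ext_K
        intro a
        change actK K _ _ = actK K _ (actK K _ _)
        rw [actK_algebraMap, actA_mul, actK_algebraMap, actK_algebraMap] }
  act_inj := by
    intro π ρ h
    ext i
    have h1 : actK K π (algebraMap A0 K (AddMonoidAlgebra.single (Finsupp.single i 1) 1)) =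
      actK K ρ (algebraMap A0 K (AddMonoidAlgebra.single (Finsupp.single i 1) 1)) :=
      DFunLike.congr_fun h _
    rw [actK_algebraMap, actK_algebraMap, (IsFractionRing.injective A0 K).eq_iff, actA_single,
      actA_single, Finsupp.equivMapDomain_single, Finsupp.equivMapDomain_single] at h1
    have h2 := single_li.injective h1
    exact Finsupp.single_left_injective one_ne_zero h2
  mon := fun a => algebraMap A0 K (AddMonoidAlgebra.single a 1)
  mon_zero := by
    rw [← AddMonoidAlgebra.one_def, map_one]
  mon_add := by
    intro a b
    rw [← map_mul, AddMonoidAlgebra.single_mul_single, one_mul]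
  mon_li := single_li.map_injOn (IsScalarTower.toAlgHom ℂ A0 K).toLinearMap
      ((IsFractionRing.injective A0 K).injOn)
  act_x := by
    intro π i
    change actK K _ _ = _
    rw [actK_algebraMap, actA_single, Finsupp.equivMapDomain_single]
end

theorem exists_fieldData : ∃ (K : Type) (_ : Field K) (_ : Algebra ℂ K), Nonempty (FieldData K) :=
  ⟨FractionRing A0, inferInstance, inferInstance, ⟨fieldData _⟩⟩

end

section
open LaurentPolynomial

noncomputable instance algRP (K : Type) [Field K] [Algebra ℂ K] : Algebra R (LaurentPolynomial K) :=
  (AddMonoidAlgebra.mapRingHom ℤ (algebraMap ℂ K)).toAlgebra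

namespace FieldData
variable {K : Type} [Field K] [Algebra ℂ K] (Φ : FieldData K)

theorem algMap_T (n : ℤ) : algebraMap R (LaurentPolynomial K) (T n) = T n := by
  change AddMonoidAlgebra.mapRingHom ℤ (algebraMap ℂ K) (AddMonoidAlgebra.single n 1) = _
  rw [AddMonoidAlgebra.mapRingHom_single, map_one]; rfl

theorem algMap_C (c : ℂ) : algebraMap R (LaurentPolynomial K) (C c) = C (algebraMap ℂ K c) := by
  change AddMonoidAlgebra.mapRingHom ℤ (algebraMap ℂ K) (AddMonoidAlgebra.single 0 c) = _
  rw [AddMonoidAlgebra.mapRingHom_single]; rfl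

theorem algMap_qq : algebraMap R (LaurentPolynomial K) qq = T 1 := algMap_T 1

theorem mon_ne (a : ℕ →₀ ℤ) : Φ.mon a ≠ 0 := by
  intro h
  have := Φ.mon_add a (-a)
  rw [add_neg_cancel, Φ.mon_zero, h, zero_mul] at this
  exact one_ne_zero this

/-- The indeterminates. -/
noncomputable def X (i : ℕ) : K := Φ.mon (Finsupp.single i 1)

theorem X_ne (i : ℕ) : Φ.X i ≠ 0 := Φ.mon_ne _

theorem X_inj : Function.Injective Φ.X := fun _ _ h =>
  Finsupp.single_left_injective one_ne_zero (Φ.mon_li.injective h)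

theorem X_sub_ne {i j : ℕ} (h : i ≠ j) : Φ.X i - Φ.X j ≠ 0 := sub_ne_zero.2 (Φ.X_inj.ne h)

/-- Action on Laurent polynomials. -/
noncomputable def actP (π : Equiv.Perm ℕ) : LaurentPolynomial K →ₐ[R] LaurentPolynomial K :=
  { AddMonoidAlgebra.mapRingHom ℤ (Φ.act π : K →+* K) with
    commutes' := fun r => by
      change AddMonoidAlgebra.mapRingHom ℤ _ (AddMonoidAlgebra.mapRingHom ℤ _ r) =
        AddMonoidAlgebra.mapRingHom ℤ _ r
      rw [← RingHom.comp_apply, ← AddMonoidAlgebra.mapRingHom_comp, AlgHom.comp_algebraMap] }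

theorem actP_C (π : Equiv.Perm ℕ) (c : K) : Φ.actP π (C c) = C (Φ.act π c) := by
  change AddMonoidAlgebra.mapRingHom ℤ _ (AddMonoidAlgebra.single 0 c) = _
  rw [AddMonoidAlgebra.mapRingHom_single]; rfl

theorem actP_T (π : Equiv.Perm ℕ) (n : ℤ) : Φ.actP π (T n) = T n := by
  rw [← algMap_T, AlgHom.commutes]

/-- The coefficient `α_{ij}` without the factor `q - 1`. -/
noncomputable def be (i j : ℕ) : K := Φ.X j / (Φ.X j - Φ.X i)

theorem ind_eq {S : Type*} [CommRing S] {f g : LaurentPolynomial K →+* S}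
    (h1 : ∀ c, f (C c) = g (C c)) (h2 : ∀ n, f (T n) = g (T n)) (p) : f p = g p := by
  induction p using LaurentPolynomial.induction_on' with
  | add p q hp hq => rw [map_add, map_add, hp, hq]
  | C_mul_T n a => rw [map_mul, map_mul, h1, h2]

/-- The representation data. -/
noncomputable def repData : RepData R (LaurentPolynomial K) where
  q := qq_unit.choose
  act :=
    { toFun := Φ.actP
      map_one' := by
        apply AlgHom.coe_ringHom_injective
        apply RingHom.ext
        apply ind_eq
        · intro c; change Φ.actP 1 _ = C c; rw [actP_C, map_one]; rfl
        · intro c; change Φ.actP 1 _ = T c; rw [actP_T]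
      map_mul' := by
        intro π ρ
        apply AlgHom.coe_ringHom_injective
        apply RingHom.ext
        apply ind_eq
        · intro c; change Φ.actP _ _ = Φ.actP _ (Φ.actP _ _); rw [actP_C, actP_C, actP_C, map_mul]; rfl
        · intro c; change Φ.actP _ _ = Φ.actP _ (Φ.actP _ _); rw [actP_T, actP_T, actP_T] }
  al := fun i j => (T 1 - 1) * C (Φ.be i j)
  x := fun i => (Units.mk0 (Φ.X i) (Φ.X_ne i)).map (C : K →+* LaurentPolynomial K).toMonoidHom
  act_al := by
    intro π i j
    change Φ.actP π _ = _
    rw [map_mul, map_sub, map_one, actP_T, actP_C, be, map_div₀, map_sub, X, X, act_x, act_x]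
    rfl
  act_x := by
    intro π i
    change Φ.actP π (C (Φ.X i)) = C (Φ.X (π i))
    rw [actP_C, X, act_x]; rfl
  a1 := by
    intro i j h
    have h1 := Φ.X_sub_ne h
    have h2 := Φ.X_sub_ne h.symm
    rw [qq_unit.choose_spec, algMap_qq, ← mul_add, ← map_add]
    have : Φ.be i j + Φ.be j i = 1 := by
      unfold be
      field_simp
      ring
    rw [this, map_one, mul_one]
  a2 := by
    intro i j l h h' h''
    have h1 := Φ.X_sub_ne h
    have h2 := Φ.X_sub_ne h.symm
    have h3 := Φ.X_sub_ne h'.symm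
    have h4 := Φ.X_sub_ne h''.symm
    have : Φ.be i j * Φ.be j l + Φ.be i l * Φ.be j i = Φ.be j l * Φ.be i l := by
      unfold be
      rw [← neg_sub (Φ.X j) (Φ.X i)]
      field_simp
      ring
    have h5 := congrArg (C : K →+* LaurentPolynomial K) this
    simp only [map_add, map_mul] at h5
    linear_combination (T 1 - 1) ^ 2 * h5
  a3 := by
    intro i j h
    have h1 := Φ.X_sub_ne h
    have h2 := Φ.X_sub_ne h.symm
    have : Φ.be i j * Φ.X i + Φ.X j * Φ.be j i = 0 := by
      unfold be
      rw [← neg_sub (Φ.X j) (Φ.X i)]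
      field_simp
      ring
    have h5 := congrArg (C : K →+* LaurentPolynomial K) this
    simp only [map_add, map_mul, map_zero] at h5
    change (T 1 - 1) * C (Φ.be i j) * C (Φ.X i) + C (Φ.X j) * ((T 1 - 1) * C (Φ.be j i)) = 0
    linear_combination (T 1 - 1) * h5

theorem repData_q : (Φ.repData.q : R) = qq := qq_unit.choose_spec

/-- Specialization at `q = 1` of the ground ring. -/
noncomputable def ev : R →+* ℂ := LaurentPolynomial.eval₂ (RingHom.id ℂ) 1

/-- Specialization at `q = 1`. -/
noncomputable def eP (K : Type) [Field K] : LaurentPolynomial K →+* K :=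
  LaurentPolynomial.eval₂ (RingHom.id K) 1

theorem eP_T (n : ℤ) : eP K (T n) = 1 := by simp [eP]
theorem eP_C (c : K) : eP K (C c) = c := by simp [eP]

theorem eP_algebraMap (r : R) : eP K (algebraMap R _ r) = algebraMap ℂ K (ev r) := by
  induction r using LaurentPolynomial.induction_on' with
  | add p q hp hq => simp only [map_add, hp, hq]
  | C_mul_T n a =>
    rw [map_mul, map_mul, algMap_C, algMap_T, eP_C, eP_T, map_mul]
    simp [ev]

theorem eP_smul (r : R) (f : LaurentPolynomial K) : eP K (r • f) = ev r • eP K f := by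
  rw [Algebra.smul_def, Algebra.smul_def, map_mul, eP_algebraMap]

theorem eP_actP (π : Equiv.Perm ℕ) (f : LaurentPolynomial K) : eP K (Φ.actP π f) = Φ.act π (eP K f) := by
  induction f using LaurentPolynomial.induction_on' with
  | add p q hp hq => simp only [map_add, hp, hq]
  | C_mul_T n a =>
    simp only [map_mul, actP_C, actP_T, eP_C, eP_T, map_one]

theorem dvd_of_ev {r : R} (h : ev r = 0) : qq - 1 ∣ r := by
  obtain ⟨n, p, hp⟩ := LaurentPolynomial.exists_T_pow r
  have h1 : p.eval 1 = 0 := by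
    have := congrArg ev hp
    rw [map_mul, h, zero_mul, ev, eval₂_toLaurent] at this
    simpa [Polynomial.eval₂_id] using this
  obtain ⟨s, hs⟩ := Polynomial.dvd_iff_isRoot.2 h1
  refine ⟨Polynomial.toLaurent s * T (-n), ?_⟩
  have h2 : r = Polynomial.toLaurent p * T (-n) := by
    rw [hp, mul_T_assoc]; simp
  rw [h2, hs, map_mul, map_sub, Polynomial.toLaurent_X, map_one, map_one, mul_assoc]
  rfl

theorem ev_qq : ev qq = 1 := by simp [ev, qq]

theorem noeth : IsNoetherianRing R :=
  IsLocalization.isNoetherianRing (Submonoid.powers (Polynomial.X : Polynomial ℂ)) R inferInstance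

theorem eq_zero_of_dvd {r : R} (h : ∀ k : ℕ, (qq - 1) ^ k ∣ r) : r = 0 := by
  by_contra h0
  have := noeth
  have h1 : ¬ IsUnit (qq - 1) := by
    intro h
    have := h.map ev
    rw [map_sub, ev_qq, map_one, sub_self] at this
    exact not_isUnit_zero this
  obtain ⟨n, hn⟩ := FiniteMultiplicity.of_not_isUnit h1 h0
  exact hn (h _)

theorem qq_sub_ne : (qq - 1 : R) ≠ 0 := by
  intro h
  have h1 := congrArg (fun r : R => r.coeff 1) (sub_eq_zero.1 h)
  rw [← T_zero] at h1
  simp [qq, -T_zero] at h1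

theorem smul_inj {f : LaurentPolynomial K} (h : (qq - 1) • f = 0) : f = 0 := by
  rw [Algebra.smul_def, mul_eq_zero] at h
  refine h.resolve_left fun h => ?_
  rw [map_sub, algMap_qq, map_one] at h
  have h1 := congrArg (fun r : LaurentPolynomial K => r.coeff 1) (sub_eq_zero.1 h)
  rw [← T_zero] at h1
  simp [-T_zero] at h1

end FieldData

end

section
open LaurentPolynomial

/-- Permutation of a descending word. -/
def pD (i : ℕ) : ℕ → Equiv.Perm ℕ
  | 0 => 1
  | (k+1) => pD i k * Equiv.swap (i - k - 1) (i - k)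

/-- Permutation of a Jones word. -/
def pJ (c : ℕ → ℕ) : ℕ → Equiv.Perm ℕ
  | 0 => 1
  | (n+1) => pJ c n * pD (n+1) (c n)

theorem pD_top (i : ℕ) : ∀ d, d ≤ i → pD i d (i - d) = i
  | 0, _ => rfl
  | (d+1), h => by
    rw [pD, Equiv.Perm.mul_apply, show i - (d+1) = i - d - 1 by omega, Equiv.swap_apply_left]
    exact pD_top i d (by omega)

theorem pD_fix (i j : ℕ) (h : i < j) : ∀ d, pD i d j = j
  | 0 => rfl
  | (d+1) => by
    rw [pD, Equiv.Perm.mul_apply, Equiv.swap_apply_of_ne_of_ne (by omega) (by omega)]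
    exact pD_fix i j h d

theorem pJ_fix (c : ℕ → ℕ) (j : ℕ) : ∀ n, n < j → pJ c n j = j
  | 0, _ => rfl
  | (n+1), h => by
    rw [pJ, Equiv.Perm.mul_apply, pD_fix _ _ h]
    exact pJ_fix c j n (by omega)

theorem pJ_inj {c c' : ℕ → ℕ} (hc : ∀ i, c i ≤ i+1) (hc' : ∀ i, c' i ≤ i+1) :
    ∀ n, pJ c n = pJ c' n → ∀ i < n, c i = c' i
  | 0, _ => fun i hi => absurd hi (by omega)
  | (n+1), h => by
    have key : ∀ c : ℕ → ℕ, (∀ i, c i ≤ i+1) → pJ c (n+1) (n+1 - c n) = n+1 := by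
      intro c hc
      rw [pJ, Equiv.Perm.mul_apply, pD_top _ _ (hc n), pJ_fix _ _ _ (by omega)]
    have h1 := key c hc
    rw [h] at h1
    have h2 := (pJ c' (n+1)).injective (h1.trans (key c' hc').symm)
    have h3 : c n = c' n := by
      have := hc n; have := hc' n; omega
    have h4 : pJ c n = pJ c' n := by
      rw [pJ, pJ, h3] at h
      exact mul_right_cancel h
    intro i hi
    rcases Nat.lt_succ_iff_lt_or_eq.1 hi with hi | rfl
    · exact pJ_inj hc hc' n h4 i hi
    · exact h3

namespace FieldData
variable {K : Type} [Field K] [Algebra ℂ K] (Φ : FieldData K)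

/-- Behaviour at `q = 1`. -/
def Q {m : ℕ} (b : B m) (v : K) (π : Equiv.Perm ℕ) : Prop :=
  ∀ F, eP K ((Φ.repData.rho m b : Module.End R (LaurentPolynomial K)) F) = v * Φ.act π (eP K F)

variable {Φ}

theorem Q_one {m : ℕ} : Φ.Q (1 : B m) 1 1 := by
  intro F
  rw [map_one, map_one]
  simp

theorem Q_mul {m : ℕ} {b b' : B m} {v v' : K} {π π' : Equiv.Perm ℕ} (h : Φ.Q b v π) (h' : Φ.Q b' v' π') :
    Φ.Q (b * b') (v * Φ.act π v') (π * π') := by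
  intro F
  rw [map_mul, Units.val_mul, Module.End.mul_apply, h, h', map_mul, map_mul, mul_assoc]
  rfl

theorem Q_inv {m : ℕ} {b : B m} {v : K} {π : Equiv.Perm ℕ} (h : Φ.Q b v π) (hv : v ≠ 0) :
    Φ.Q b⁻¹ (Φ.act π⁻¹ v⁻¹) π⁻¹ := by
  intro F
  have h1 := h ((Φ.repData.rho m b⁻¹ : Module.End R (LaurentPolynomial K)) F)
  rw [← Module.End.mul_apply, ← Units.val_mul, ← map_mul, mul_inv_cancel, map_one] at h1
  have h2 : ∀ z, Φ.act π⁻¹ (Φ.act π z) = z := by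
    intro z
    have : (Φ.act π⁻¹ * Φ.act π) z = z := by rw [← map_mul, inv_mul_cancel, map_one]; rfl
    exact this
  rw [← map_mul]
  have h3 : eP K F = v * Φ.act π (eP K ((Φ.repData.rho m b⁻¹ : Module.End R (LaurentPolynomial K)) F)) := h1
  rw [h3, inv_mul_cancel_left₀ hv, h2]

theorem Q_sigma {m : ℕ} (i : Fin m) : Φ.Q (σ i) 1 (Equiv.swap (i : ℕ) (i+1)) := by
  intro F
  rw [RepData.rho_sigma, RepData.Top_apply, repData_q, algMap_qq]
  change eP K ((T 1 - 1) * C (Φ.be i (i+1)) * F + (T 1 - (T 1 - 1) * C (Φ.be i (i+1))) *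
    Φ.actP (Equiv.swap (i : ℕ) (i+1)) F) = _
  simp only [map_add, map_mul, map_sub, eP_T, map_one, eP_actP]
  ring

theorem Q_sig {m j : ℕ} (h1 : 1 ≤ j) (h2 : j ≤ m) : Φ.Q (sig j : B m) 1 (Equiv.swap (j-1) j) := by
  rw [sig_of h1 h2]
  have := Q_sigma (Φ := Φ) (⟨j-1, by omega⟩ : Fin m)
  simpa [Nat.sub_add_cancel h1] using this

theorem Q_tau {m : ℕ} : Φ.Q (τ : B m) (Φ.X 0) 1 := by
  intro F
  rw [RepData.rho_tau, RepData.Xop_apply, map_one]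
  change eP K (C (Φ.X 0) * F) = _
  rw [map_mul, eP_C]; rfl

theorem Q_tp {m : ℕ} : ∀ j, j ≤ m → Φ.Q (tp j : B m) (Φ.X j) 1
  | 0, _ => Q_tau
  | (j+1), h => by
    have hs := Q_sig (Φ := Φ) (m := m) (j := j+1) (by omega) h
    have := Q_mul (Q_mul hs (Q_tp j (by omega))) (Q_inv hs one_ne_zero)
    simpa [X, Φ.act_x, tp] using this

theorem Q_pow {m : ℕ} {b : B m} {v : K} (h : Φ.Q b v 1) (hv : v ≠ 0) (k : ℤ) : Φ.Q (b ^ k) (v ^ k) 1 := by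
  induction k using Int.induction_on with
  | zero => simpa using Q_one
  | succ n ih =>
    rw [zpow_add_one, zpow_add_one₀ hv]
    simpa using Q_mul ih h
  | pred n ih =>
    rw [zpow_sub_one, zpow_sub_one₀ hv]
    simpa using Q_mul ih (Q_inv h hv)

theorem mon_zsmul (i : ℕ) (k : ℤ) : Φ.mon (Finsupp.single i k) = Φ.X i ^ k := by
  induction k using Int.induction_on with
  | zero => simpa using Φ.mon_zero
  | succ n ih => rw [zpow_add_one₀ (Φ.X_ne i), ← ih, Finsupp.single_add, Φ.mon_add]; rfl
  | pred n ih =>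
    rw [zpow_sub_one₀ (Φ.X_ne i), ← ih, eq_mul_inv_iff_mul_eq₀ (Φ.X_ne i), X, ← Φ.mon_add,
      ← Finsupp.single_add, sub_add_cancel]

/-- Exponent vector. -/
noncomputable def ex (e : ℕ → ℤ) (n : ℕ) : ℕ →₀ ℤ := ∑ i ∈ Finset.range n, Finsupp.single i (e i)

theorem ex_apply (e : ℕ → ℤ) (n i : ℕ) (h : i < n) : ex e n i = e i := by
  simp [ex, Finsupp.finsetSum_apply, Finsupp.single_apply, h]

theorem Q_TT {m : ℕ} (e : ℕ → ℤ) : ∀ n, n ≤ m + 1 → Φ.Q (TT e n : B m) (Φ.mon (ex e n)) 1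
  | 0, _ => by simpa [ex, TT, Φ.mon_zero] using Q_one
  | (n+1), h => by
    have := Q_mul (Q_TT e n (by omega)) (Q_pow (Q_tp (Φ := Φ) n (by omega : n ≤ m)) (Φ.X_ne n) (e n))
    rw [ex, Finset.sum_range_succ, Φ.mon_add, mon_zsmul]
    simpa [TT, ex] using this

theorem Q_DD {m : ℕ} (i : ℕ) (hi : i ≤ m) : ∀ d, d ≤ i → Φ.Q (DD i d : B m) 1 (pD i d)
  | 0, _ => Q_one
  | (d+1), h => by
    have := Q_mul (Q_DD i hi d (by omega)) (Q_sig (Φ := Φ) (m := m) (j := i - d) (by omega) (by omega))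
    simpa [DD, pD] using this

theorem Q_JJ {m : ℕ} (c : ℕ → ℕ) (hc : ∀ i, c i ≤ i + 1) : ∀ n, n ≤ m → Φ.Q (JJ c n : B m) 1 (pJ c n)
  | 0, _ => Q_one
  | (n+1), h => by
    have := Q_mul (Q_JJ c hc n (by omega)) (Q_DD (Φ := Φ) (m := m) (n+1) (by omega) (c n) (hc n))
    simpa [JJ, pJ] using this

theorem Q_elt {m : ℕ} (e : ℕ → ℤ) (c : ℕ → ℕ) (hc : ∀ i, c i ≤ i + 1) :
    Φ.Q (TT e (m+1) * JJ c m : B m) (Φ.mon (ex e (m+1))) (pJ c m) := by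
  simpa using Q_mul (Q_TT (Φ := Φ) e (m+1) le_rfl) (Q_JJ c hc m le_rfl)

variable (Φ)

theorem li_basic : LinearIndependent ℂ
    (fun p : (ℕ →₀ ℤ) × Equiv.Perm ℕ => (fun f : K => Φ.mon p.1 * Φ.act p.2 f)) := by
  have h1 : LinearIndependent K (fun π : Equiv.Perm ℕ => (fun f : K => Φ.act π f)) := by
    refine (linearIndependent_monoidHom K K).comp (fun π : Equiv.Perm ℕ => ((Φ.act π : K →+* K) : K →* K)) ?_
    intro π ρ h
    apply Φ.act_inj
    ext f
    exact DFunLike.congr_fun h f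
  exact linearIndependent_smul Φ.mon_li h1

theorem li_main {K : Type} [Field K] [Algebra ℂ K] (Φ : FieldData K) (m : ℕ) : LinearIndependent R (fun x : SigmaPrimeSet m => (x : H m)) := by
  obtain ⟨F, hF⟩ := exists_rep Φ.repData Φ.repData_q m
  choose e c hc hx using fun x : SigmaPrimeSet m => (sigmaPrime_iff x.1).1 x.2
  have hinj : Function.Injective (fun x : SigmaPrimeSet m => (ex (e x) (m+1), pJ (c x) m)) := by
    intro x y hxy
    simp only [Prod.mk.injEq] at hxy
    apply Subtype.ext
    rw [hx x, hx y, TT_congr (e := e x) (e' := e y), JJ_congr (e := c x) (e' := c y)]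
    · exact pJ_inj (hc x) (hc y) m hxy.2
    · intro i hi
      rw [← ex_apply (e x) (m+1) i hi, hxy.1, ex_apply _ _ _ hi]
  have hli := Φ.li_basic.comp _ hinj
  refine LinearIndependent.of_comp F.toLinearMap ?_
  rw [linearIndependent_iff'] at hli ⊢
  intro s
  have step : ∀ g : SigmaPrimeSet m → R, ∑ x ∈ s, g x • F (x : H m) = 0 →
      ∀ x ∈ s, ev (g x) = 0 := by
    intro g hg
    apply hli s (fun x => ev (g x))
    funext f
    have h1 := congrArg (fun E : Module.End R (LaurentPolynomial K) => eP K (E (C f))) hg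
    simp only [LinearMap.sum_apply, LinearMap.smul_apply, map_sum, eP_smul, LinearMap.zero_apply,
      map_zero] at h1
    rw [Finset.sum_apply]
    refine Eq.trans (Finset.sum_congr rfl fun x _ => ?_) h1
    conv_rhs => rw [hx x, hF, Q_elt (Φ := Φ) (e x) (c x) (hc x), eP_C]
    rfl
  have step2 : ∀ k : ℕ, ∀ g : SigmaPrimeSet m → R, ∑ x ∈ s, g x • F (x : H m) = 0 →
      ∀ x ∈ s, (qq - 1) ^ k ∣ g x := by
    intro k
    induction k with
    | zero => intro g _ x _; simp
    | succ k ih =>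
      intro g hg
      have h1 : ∀ x, ∃ r, x ∈ s → g x = (qq - 1) * r := by
        intro x
        by_cases hxs : x ∈ s
        · obtain ⟨r, hr⟩ := dvd_of_ev (step g hg x hxs)
          exact ⟨r, fun _ => hr⟩
        · exact ⟨0, fun h => absurd h hxs⟩
      choose g' hg' using h1
      have h2 : ∑ x ∈ s, g' x • F (x : H m) = 0 := by
        refine LinearMap.ext fun f => ?_
        apply smul_inj
        rw [← LinearMap.smul_apply, Finset.smul_sum]
        have : ∑ x ∈ s, (qq - 1) • g' x • F (x : H m) = 0 := by
          rw [← hg]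
          refine Finset.sum_congr rfl fun x hxs => ?_
          rw [hg' x hxs, mul_smul]
        rw [this]; rfl
      intro x hxs
      rw [hg' x hxs, pow_succ']
      exact mul_dvd_mul_left _ (ih g' h2 x hxs)
  intro g hg x hxs
  exact eq_zero_of_dvd fun k => step2 k g hg x hxs

end FieldData

theorem lin_indep (m : ℕ) : LinearIndependent R (fun x : SigmaPrimeSet m => (x : H m)) := by
  obtain ⟨K, _, _, ⟨Φ⟩⟩ := exists_fieldData
  exact Φ.li_main m

end

/-- The set `Σ′_n` is a basis of `H_{1,n}(q)` as an `R`-module. -/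
theorem sigma_prime_basis (m : ℕ) :
    LinearIndependent R (fun x : SigmaPrimeSet m => (x : H m)) ∧
    Submodule.span R (SigmaPrimeSet m) = ⊤ := by
  exact ⟨lin_indep m, span_top m⟩

end MB
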